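/- Let r∈ℕ, let r_{ij}∈ℕ and 𝐡_{ij}^k∈K² for i,j∈[r] and k∈[r_{ij}] satisfy 𝐡_{ij}^k ∉ 𝐡_{ij}^l + ℤ² for k≠l, and let c^α ∈ E⌊𝐳₁,…,𝐳ᵣ⌋ for each α∈Π_{i<j}[r_{ij}]. If Σ_α (Π_{i<j}(𝐳_i−𝐳_j)^{−𝐡_{ij}^{α(i,j)}})·c^α(𝐳₁,…,𝐳ᵣ) = 0, then c^α = 0 for every α. -/

import Mathlib

open scoped BigOperators Classical

noncomputable section

namespace OPEA

variable (K : Type*) [Field K] [CharZero K]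

/-- index pairs 𝐧 = (n, n̄) ∈ K² -/
abbrev Idx := K × K

def IsInt (x : K) : Prop := ∃ k : ℤ, (k : K) = x

def IsNegInt (x : K) : Prop := ∃ k : ℤ, k < 0 ∧ (k : K) = x

/-- 𝕂̄ = {𝐧 ∈ K² | n − n̄ ∈ ℤ} -/
def Kbar (n : Idx K) : Prop := IsInt K (n.1 - n.2)

def IsIntPair (n : Idx K) : Prop := IsInt K n.1 ∧ IsInt K n.2

/-- generalized binomial coefficient C(x,k) -/
def gchoose (x : K) (k : ℕ) : K :=
  (∏ i ∈ Finset.range k, (x - (i : K))) / (k.factorial : K)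

/-- (−1)^x for x an integer image in K (and 1 otherwise) -/
def negOnePow (x : K) : K :=
  if h : ∃ k : ℤ, (k : K) = x then (-1 : K) ^ h.choose else 1

variable (M : Type*) [AddCommGroup M] [Module K M]

/-- M-valued distribution in one variable pair -/
abbrev Dist1 := Idx K → M

/-- M-valued distribution in two variable pairs -/
abbrev Dist2 := Idx K → Idx K → M

/-- M-valued distribution in r variable pairs -/
abbrev DistN (r : ℕ) := (Fin r → Idx K) → M

/-- membership in M[[𝐳]] -/
def IsPow1 (a : Dist1 K M) : Prop := ∀ n, a n ≠ 0 → IsNegInt K n.1 ∧ IsNegInt K n.2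

/-- membership in M⌊𝐳⌋ -/
def InLat1 (a : Dist1 K M) : Prop :=
  ∃ S : Finset (Idx K), ∀ n, a n ≠ 0 →
    ∃ m ∈ S, IsNegInt K (n.1 - m.1) ∧ IsNegInt K (n.2 - m.2)

/-- membership in M[[𝐳,𝐰]] -/
def IsPow2 (a : Dist2 K M) : Prop :=
  ∀ n k, a n k ≠ 0 →
    (IsNegInt K n.1 ∧ IsNegInt K n.2) ∧ (IsNegInt K k.1 ∧ IsNegInt K k.2)

/-- membership in M⌊𝐳,𝐰⌋ -/
def InLat2 (a : Dist2 K M) : Prop :=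
  ∃ S : Finset (Idx K × Idx K), ∀ n k, a n k ≠ 0 →
    ∃ m ∈ S, (IsNegInt K (n.1 - m.1.1) ∧ IsNegInt K (n.2 - m.1.2)) ∧
      (IsNegInt K (k.1 - m.2.1) ∧ IsNegInt K (k.2 - m.2.2))

/-- membership in M[[𝐳₁,…,𝐳ᵣ]] -/
def IsPowN {r : ℕ} (a : DistN K M r) : Prop :=
  ∀ n, a n ≠ 0 → ∀ i, IsNegInt K (n i).1 ∧ IsNegInt K (n i).2

/-- membership in M⌊𝐳₁,…,𝐳ᵣ⌋ -/
def InLatN {r : ℕ} (a : DistN K M r) : Prop :=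
  ∃ S : Finset (Fin r → Idx K), ∀ n, a n ≠ 0 →
    ∃ m ∈ S, ∀ i, IsNegInt K ((n i).1 - (m i).1) ∧ IsNegInt K ((n i).2 - (m i).2)

/-- ∂_z -/
def dz (a : Dist1 K M) : Dist1 K M := fun n => (-n.1) • a (n.1 - 1, n.2)

/-- ∂_z̄ -/
def dzb (a : Dist1 K M) : Dist1 K M := fun n => (-n.2) • a (n.1, n.2 - 1)

/-- ∂ in the first variable pair of a two-variable distribution (z-component) -/
def d1z (c : Dist2 K M) : Dist2 K M := fun n k => (-n.1) • c (n.1 - 1, n.2) k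

/-- ∂ in the first variable pair of a two-variable distribution (z̄-component) -/
def d1zb (c : Dist2 K M) : Dist2 K M := fun n k => (-n.2) • c (n.1, n.2 - 1) k

/-- divided power d^{(x)} of an operator d, for a K-valued exponent x
(zero unless x ∈ ℕ) -/
def dPow {A : Type*} [AddCommGroup A] [Module K A] (d : A → A) (x : K) (a : A) : A :=
  if h : ∃ j : ℕ, (j : K) = x then ((h.choose.factorial : K))⁻¹ • d^[h.choose] a else 0

/-- ∂_z^{(e_1)} ∂_z̄^{(e_2)} in the first variable pair -/
def ddPow2 (e : Idx K) (c : Dist2 K M) : Dist2 K M :=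
  dPow K (d1z K M) e.1 (dPow K (d1zb K M) e.2 c)

/-- the diagonal map c(𝐳,𝐰) ↦ c(𝐰,𝐰) -/
def diag (c : Dist2 K M) : Dist1 K M :=
  fun n => ∑ᶠ m : Idx K, c m (n.1 - m.1 - 1, n.2 - m.2 - 1)

/-- multiplication by (𝐳−𝐰)^h (expansion in z>w), on coefficients;
first index is 𝐳, second is 𝐰 -/
def zwPow (h : Idx K) (c : Dist2 K M) : Dist2 K M :=
  fun m k => ∑ᶠ i : ℕ × ℕ,
    ((-1 : K) ^ (i.1 + i.2) * gchoose K h.1 i.1 * gchoose K h.2 i.2) •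
      c (m.1 + h.1 - i.1, m.2 + h.2 - i.2) (k.1 + i.1, k.2 + i.2)

/-- multiplication by ((𝐳−𝐰)_{w>z})^h = (−1)^h (𝐰−𝐳)^h (expansion in w>z) -/
def zwPowW (h : Idx K) (c : Dist2 K M) : Dist2 K M :=
  fun m k => ∑ᶠ i : ℕ × ℕ,
    (negOnePow K (h.1 - h.2) * (-1 : K) ^ (i.1 + i.2) *
        gchoose K h.1 i.1 * gchoose K h.2 i.2) •
      c (m.1 + i.1, m.2 + i.2) (k.1 + h.1 - i.1, k.2 + h.2 - i.2)

/-- multiplication by (𝐱+𝐰)^N of a distribution d(𝐰,𝐱) (first index 𝐰, second 𝐱);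
the result is indexed by (x-index, w-index) -/
def xwPow (N : Idx K) (d : Dist2 K M) : Dist2 K M :=
  fun m k => ∑ᶠ i : ℕ × ℕ, (gchoose K N.1 i.1 * gchoose K N.2 i.2) •
    d (k.1 + i.1, k.2 + i.2) (m.1 + N.1 - i.1, m.2 + N.2 - i.2)

/-- multiplication by (𝐰+𝐱)^N of a distribution d(𝐰,𝐱) (first index 𝐰, second 𝐱);
the result is indexed by (x-index, w-index) -/
def wxPow (N : Idx K) (d : Dist2 K M) : Dist2 K M :=
  fun m k => ∑ᶠ i : ℕ × ℕ, (gchoose K N.1 i.1 * gchoose K N.2 i.2) •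
    d (k.1 + N.1 - i.1, k.2 + N.2 - i.2) (m.1 + i.1, m.2 + i.2)

/-- multiplication by 𝐱^A 𝐰^B (𝐱+𝐰)^N of p(𝐰,𝐱); result indexed (x-index, w-index) -/
def tripleXW (A B N : Idx K) (p : Dist2 K M) : Dist2 K M :=
  fun m k => ∑ᶠ l : ℕ × ℕ, (gchoose K N.1 l.1 * gchoose K N.2 l.2) •
    p (k.1 + B.1 + l.1, k.2 + B.2 + l.2) (m.1 + A.1 + N.1 - l.1, m.2 + A.2 + N.2 - l.2)

/-- multiplication by 𝐱^A 𝐰^B (𝐰+𝐱)^N of p(𝐰,𝐱); result indexed (x-index, w-index) -/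
def tripleWX (A B N : Idx K) (p : Dist2 K M) : Dist2 K M :=
  fun m k => ∑ᶠ l : ℕ × ℕ, (gchoose K N.1 l.1 * gchoose K N.2 l.2) •
    p (k.1 + B.1 + N.1 - l.1, k.2 + B.2 + N.2 - l.2) (m.1 + A.1 + l.1, m.2 + A.2 + l.2)

variable (E : Type*) [AddCommGroup E] [Module K E]

/-- End(E)-valued distributions in one variable pair -/
abbrev EDist1 := Dist1 K (Module.End K E)

/-- End(E)-valued distributions in two variable pairs -/
abbrev EDist2 := Dist2 K (Module.End K E)

/-- End(E)-valued distributions in r variable pairs -/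
abbrev EDistN (r : ℕ) := DistN K (Module.End K E) r

def ev1 (a : EDist1 K E) (v : E) : Dist1 K E := fun n => a n v

def ev2 (c : EDist2 K E) (v : E) : Dist2 K E := fun n k => c n k v

def evN {r : ℕ} (c : EDistN K E r) (v : E) : DistN K E r := fun n => c n v

/-- a(𝐳) is a field -/
def IsFieldD (a : EDist1 K E) : Prop := ∀ v, InLat1 K E (ev1 K E a v)

/-- a field in two variable pairs -/
def IsField2D (c : EDist2 K E) : Prop := ∀ v, InLat2 K E (ev2 K E c v)

/-- the Koszul sign (−1)^{pq} -/
def koszul (p q : ZMod 2) : K := if p = 1 ∧ q = 1 then (-1 : K) else 1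

/-- the data (c^i, 𝐡_i) is an OPE of the homogeneous distributions a(𝐳), b(𝐳)
of parities pa, pb (all identities to be read applied to each vector of E) -/
def IsOPE (pa pb : ZMod 2) (a b : EDist1 K E) {r : ℕ}
    (c : Fin r → EDist2 K E) (h : Fin r → Idx K) : Prop :=
  (∀ i, Kbar K (h i)) ∧ (∀ i, IsField2D K E (c i)) ∧
  (∀ v m k, a m (b k v) = ∑ i, zwPow K E (-(h i)) (ev2 K E (c i) v) m k) ∧
  (∀ v m k, koszul K pa pb • (b k (a m v)) =
      ∑ i, zwPowW K E (-(h i)) (ev2 K E (c i) v) m k)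

/-- a(𝐳), b(𝐳) (homogeneous of parities pa, pb) are local -/
def IsLocal (pa pb : ZMod 2) (a b : EDist1 K E) : Prop :=
  ∃ (r : ℕ) (c : Fin r → EDist2 K E) (h : Fin r → Idx K), IsOPE K E pa pb a b c h

/-- the exponents of an OPE are reduced: 𝐡_i ∉ 𝐡_j + ℤ² for i ≠ j -/
def ReducedExp {r : ℕ} (h : Fin r → Idx K) : Prop :=
  ∀ i j, i ≠ j → ¬ IsIntPair K (h i - h j)

/-- the product field a(𝐰)_{(𝐧)}b(𝐰) built from an OPE (c,h), applied to a vector v -/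
def prodAt {r : ℕ} (c : Fin r → EDist2 K E) (h : Fin r → Idx K) (n : Idx K)
    (v : E) : Dist1 K E :=
  fun m => ∑ i, diag K E
    (ddPow2 K E ((h i).1 - 1 - n.1, (h i).2 - 1 - n.2) (ev2 K E (c i) v)) m

/-- s₁ : a(𝐳) ↦ a_{(−1,−1)}1 -/
def s1 (one : E) (a : EDist1 K E) : E := a ((-1 : K), (-1 : K)) one

/-- the distribution d (to be thought of as a(𝐳)1) equals
Σ_{𝐢∈ℕ²} T^{(i)} T̄^{(ī)} (d_{(−1,−1)}) 𝐳^𝐢, i.e. a(𝐳) is creative -/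
def CreativeD (T Tb : Module.End K E) (d : Dist1 K E) : Prop :=
  (∀ i : ℕ × ℕ, d (-(i.1 : K) - 1, -(i.2 : K) - 1) =
      ((i.1.factorial : K)⁻¹ * (i.2.factorial : K)⁻¹) •
        ((T ^ i.1) * (Tb ^ i.2)) (d ((-1 : K), (-1 : K)))) ∧
  (∀ n : Idx K, (¬ ∃ i : ℕ × ℕ, n = (-(i.1 : K) - 1, -(i.2 : K) - 1)) → d n = 0)

/-- a(𝐳) is translation covariant for (T, T̄) -/
def TransCov (T Tb : Module.End K E) (a : EDist1 K E) : Prop :=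
  (∀ n : Idx K, T * a n - a n * T = (-n.1) • a (n.1 - 1, n.2)) ∧
  (∀ n : Idx K, Tb * a n - a n * Tb = (-n.2) • a (n.1, n.2 - 1))

/-- translation covariance of a product field, per vector -/
def TransCovAt (T Tb : Module.End K E) (P : E → Dist1 K E) : Prop :=
  (∀ v (m : Idx K), T (P v m) - P (T v) m = (-m.1) • P v (m.1 - 1, m.2)) ∧
  (∀ v (m : Idx K), Tb (P v m) - P (Tb v) m = (-m.2) • P v (m.1, m.2 - 1))

/-- the identity field 1(z) = id_E -/
def idField : EDist1 K E :=
  fun n => if n = ((-1 : K), (-1 : K)) then (1 : Module.End K E) else 0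

/-- pairs i < j in [r] -/
abbrev Pairs (r : ℕ) := {p : Fin r × Fin r // p.1 < p.2}

/-- the index shift of the i-th variable produced by the monomial of a binomial
expansion of ((𝐳_{p₁} − 𝐳_{p₂})_σ)^h belonging to 𝐤 ∈ ℕ² -/
def pairShift {r : ℕ} (p : Pairs r) (h : Idx K) (flip : Bool) (kk : ℕ × ℕ)
    (i : Fin r) : Idx K :=
  if i = p.1.1 then
    (if flip then ((kk.1 : K), (kk.2 : K)) else (h.1 - kk.1, h.2 - kk.2))
  else if i = p.1.2 then
    (if flip then (h.1 - kk.1, h.2 - kk.2) else ((kk.1 : K), (kk.2 : K)))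
  else 0

/-- the coefficient of a binomial expansion of ((𝐳_{p₁} − 𝐳_{p₂})_σ)^h
belonging to 𝐤 ∈ ℕ² -/
def pairCoef (h : Idx K) (flip : Bool) (kk : ℕ × ℕ) : K :=
  (if flip then negOnePow K (h.1 - h.2) else 1) * (-1 : K) ^ (kk.1 + kk.2) *
    gchoose K h.1 kk.1 * gchoose K h.2 kk.2

def flipOf {r : ℕ} (σ : Equiv.Perm (Fin r)) (p : Pairs r) : Bool :=
  decide (σ.symm p.1.2 < σ.symm p.1.1)

/-- multiplication by Π_{i<j} ((𝐳_i − 𝐳_j)_σ)^{h_{ij}} on an r-variable distribution -/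
def permMul {r : ℕ} (σ : Equiv.Perm (Fin r)) (hs : Pairs r → Idx K)
    (c : DistN K M r) : DistN K M r :=
  fun m => ∑ᶠ κ : Pairs r → ℕ × ℕ,
    (∏ p : Pairs r, pairCoef K (hs p) (flipOf σ p) (κ p)) •
      c (fun i => m i + ∑ p : Pairs r, pairShift K p (hs p) (flipOf σ p) (κ p) i)

/-- the Koszul sign ζ' produced by reordering a¹,…,aʳ into a^{σ1},…,a^{σr} -/
def koszulPerm {r : ℕ} (ps : Fin r → ZMod 2) (σ : Equiv.Perm (Fin r)) : K :=
  ∏ p : Pairs r,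
    if σ.symm p.1.2 < σ.symm p.1.1 ∧ ps p.1.1 = 1 ∧ ps p.1.2 = 1 then (-1 : K) else 1

/-- the composition a^{σ1}(𝐳_{σ1})_{m_{σ1}} ∘ ⋯ ∘ a^{σr}(𝐳_{σr})_{m_{σr}} applied to v -/
def compSeq {r : ℕ} (a : Fin r → EDist1 K E) (σ : Equiv.Perm (Fin r))
    (m : Fin r → Idx K) (v : E) : E :=
  (List.ofFn fun j : Fin r => σ j).foldr (fun i acc => a i (m i) acc) v

/-- the data (c^α, 𝐡_{ij}^k) is a (multiple) OPE of the homogeneous distributions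
a¹(𝐳),…,aʳ(𝐳) of parities ps -/
def IsMultOPE {r : ℕ} (a : Fin r → EDist1 K E) (ps : Fin r → ZMod 2)
    (rij : Fin r → Fin r → ℕ) (hs : ∀ i j : Fin r, Fin (rij i j) → Idx K)
    (c : ((p : Pairs r) → Fin (rij p.1.1 p.1.2)) → EDistN K E r) : Prop :=
  (∀ i j k, Kbar K (hs i j k)) ∧
  (∀ α v, InLatN K E (evN K E (c α) v)) ∧
  (∀ σ : Equiv.Perm (Fin r), ∀ v m,
    koszulPerm K ps σ • compSeq K E a σ m v =
      ∑ α : (p : Pairs r) → Fin (rij p.1.1 p.1.2),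
        permMul K E σ (fun p => -(hs p.1.1 p.1.2 (α p))) (evN K E (c α) v) m)

/-- a¹(𝐳),…,aʳ(𝐳) are multiply local -/
def MultiplyLocal {r : ℕ} (a : Fin r → EDist1 K E) (ps : Fin r → ZMod 2) : Prop :=
  ∃ (rij : Fin r → Fin r → ℕ) (hs : ∀ i j : Fin r, Fin (rij i j) → Idx K)
    (c : ((p : Pairs r) → Fin (rij p.1.1 p.1.2)) → EDistN K E r),
      IsMultOPE K E a ps rij hs c

/-- a set of homogeneous fields (with parities pF) is multiply local -/
def MultLocalSet (F : Set (EDist1 K E)) (pF : EDist1 K E → ZMod 2) : Prop :=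
  ∀ (r : ℕ) (f : Fin r → EDist1 K E), (∀ i, f i ∈ F) →
    MultiplyLocal K E f (fun i => pF (f i))

/-- a set of homogeneous fields (with parities pF) is uniformly local -/
def UnifLocalSet (F : Set (EDist1 K E)) (pF : EDist1 K E → ZMod 2) (one : E) : Prop :=
  ∃ (rr : EDist1 K E → EDist1 K E → ℕ)
    (hh : ∀ d e : EDist1 K E, Fin (rr d e) → Idx K),
    ∀ (r : ℕ) (f : Fin r → EDist1 K E), (∀ i, f i ∈ F) →
      ∃ c, IsMultOPE K E f (fun i => pF (f i)) (fun i j => rr (f i) (f j))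
          (fun i j => hh (f i) (f j)) c ∧
        ∀ α, IsPowN K E (evN K E (c α) one)

/-- a ∈ V is homogeneous of parity p w.r.t. the grading (ev, od) -/
def memPar {V : Type*} [AddCommGroup V] [Module K V] (ev od : Submodule K V)
    (a : V) (p : ZMod 2) : Prop :=
  (p = 0 ∧ a ∈ ev) ∨ (p = 1 ∧ a ∈ od)

/-- an endomorphism is homogeneous of parity p w.r.t. the grading (ev, od) -/
def EndPar {V : Type*} [AddCommGroup V] [Module K V] (ev od : Submodule K V)
    (f : Module.End K V) (p : ZMod 2) : Prop :=
  if p = 0 then (∀ v ∈ ev, f v ∈ ev) ∧ (∀ v ∈ od, f v ∈ od)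
  else (∀ v ∈ ev, f v ∈ od) ∧ (∀ v ∈ od, f v ∈ ev)

/-- a distribution is homogeneous of parity p -/
def EDistPar {V : Type*} [AddCommGroup V] [Module K V] (ev od : Submodule K V)
    (a : EDist1 K V) (p : ZMod 2) : Prop :=
  ∀ n, EndPar K ev od (a n) p

end OPEA

namespace OPEA

/-- an OPE-algebra -/
structure OPEAlg (K : Type*) [Field K] [CharZero K]
    (V : Type*) [AddCommGroup V] [Module K V] where
  ev : Submodule K V
  od : Submodule K V
  compl : IsCompl ev od
  Y : V →ₗ[K] EDist1 K V
  Y_par : ∀ a p, memPar K ev od a p → ∀ (n : Idx K) b q, memPar K ev od b q →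
    memPar K ev od (Y a n b) (p + q)
  one : V
  one_ev : one ∈ ev
  T : Module.End K V
  Tb : Module.End K V
  T_ev : EndPar K ev od T 0
  Tb_ev : EndPar K ev od Tb 0
  commTTb : T * Tb = Tb * T
  T_one : T one = 0
  Tb_one : Tb one = 0
  wcre : ∀ a, IsPow1 K V (ev1 K V (Y a) one)
  rid : ∀ a, Y a ((-1 : K), (-1 : K)) one = a
  tcov : ∀ a, TransCov K V T Tb (Y a)
  loc : ∀ a b pa pb, memPar K ev od a pa → memPar K ev od b pb →
    IsLocal K V pa pb (Y a) (Y b)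

/-- a bounded 𝕂̄-fold algebra -/
structure BFold (K : Type*) [Field K] [CharZero K]
    (V : Type*) [AddCommGroup V] [Module K V] where
  ev : Submodule K V
  od : Submodule K V
  compl : IsCompl ev od
  Y : V →ₗ[K] EDist1 K V
  Y_par : ∀ a p, memPar K ev od a p → ∀ (n : Idx K) b q, memPar K ev od b q →
    memPar K ev od (Y a n b) (p + q)
  fields : ∀ a, IsFieldD K V (Y a)
  bounded : ∀ a (n : Idx K), ¬ Kbar K n → ∀ b, Y a n b = 0

/-- a bounded 𝕂̄-fold module over a bounded 𝕂̄-fold algebra -/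
structure BMod (K : Type*) [Field K] [CharZero K]
    (V : Type*) [AddCommGroup V] [Module K V] (A : BFold K V)
    (Mo : Type*) [AddCommGroup Mo] [Module K Mo] where
  evM : Submodule K Mo
  odM : Submodule K Mo
  complM : IsCompl evM odM
  YM : V →ₗ[K] EDist1 K Mo
  YM_par : ∀ a p, memPar K A.ev A.od a p → ∀ n : Idx K, EndPar K evM odM (YM a n) p
  fieldsM : ∀ a, IsFieldD K Mo (YM a)
  boundedM : ∀ a (n : Idx K), ¬ Kbar K n → ∀ c, YM a n c = 0

variable (K : Type*) [Field K] [CharZero K]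
variable (V : Type*) [AddCommGroup V] [Module K V]
variable (Mo : Type*) [AddCommGroup Mo] [Module K Mo]

/-- the operator T₁ : a ↦ a_{(−2,−1)}1 of an OPE-algebra -/
def T1 (A : OPEAlg K V) : Module.End K V where
  toFun := fun a => A.Y a ((-2 : K), (-1 : K)) A.one
  map_add' := by
    intro x y
    simp [map_add, Pi.add_apply, LinearMap.add_apply]
  map_smul' := by
    intro c x
    simp [map_smul, Pi.smul_apply, LinearMap.smul_apply]

/-- the operator T̄₁ : a ↦ a_{(−1,−2)}1 of an OPE-algebra -/
def T1b (A : OPEAlg K V) : Module.End K V where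
  toFun := fun a => A.Y a ((-1 : K), (-2 : K)) A.one
  map_add' := by
    intro x y
    simp [map_add, Pi.add_apply, LinearMap.add_apply]
  map_smul' := by
    intro c x
    simp [map_smul, Pi.smul_apply, LinearMap.smul_apply]

/-- skew-symmetry for the pair (T, T̄) -/
def SkewSym (ev od : Submodule K V) (Yf : V → EDist1 K V)
    (T Tb : Module.End K V) : Prop :=
  ∀ a b pa pb, memPar K ev od a pa → memPar K ev od b pb →
    ∀ n : Idx K, Kbar K n →
      (Function.support (fun i : ℕ × ℕ =>
        ((i.1.factorial : K)⁻¹ * (i.2.factorial : K)⁻¹ *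
            negOnePow K (n.1 + i.1 - (n.2 + i.2))) •
          ((T ^ i.1) * (Tb ^ i.2)) (Yf a (n.1 + i.1, n.2 + i.2) b))).Finite ∧
      koszul K pa pb • Yf b n a =
        ∑ᶠ i : ℕ × ℕ, ((i.1.factorial : K)⁻¹ * (i.2.factorial : K)⁻¹ *
            negOnePow K (n.1 + i.1 - (n.2 + i.2))) •
          ((T ^ i.1) * (Tb ^ i.2)) (Yf a (n.1 + i.1, n.2 + i.2) b)

/-- (T, T̄) is a translation endomorphism of the module with state-field map YM -/
def TransEnd (YM : V → EDist1 K Mo) (T Tb : Module.End K V) : Prop :=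
  (∀ a (n : Idx K), YM (T a) n = (-n.1) • YM a (n.1 - 1, n.2)) ∧
  (∀ a (n : Idx K), YM (Tb a) n = (-n.2) • YM a (n.1, n.2 - 1))

/-- the coefficient at (x-index m, w-index k) of a(𝐱+𝐰) applied to the w-distribution bw -/
def lhsXW (YM : V → EDist1 K Mo) (a : V) (bw : Dist1 K Mo) (m k : Idx K) : Mo :=
  ∑ᶠ i : ℕ × ℕ, ((i.1.factorial : K)⁻¹ * (i.2.factorial : K)⁻¹) •
    (((dz K (Module.End K Mo))^[i.1] ((dzb K (Module.End K Mo))^[i.2] (YM a))) m)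
      (bw (k.1 + i.1, k.2 + i.2))

/-- a and cM are dual in the direct channel -/
def DualDirect (Y : V → EDist1 K V) (YM : V → EDist1 K Mo) (a : V) (cM : Mo) : Prop :=
  ∃ (s : ℕ) (d : Fin s → Idx K → Idx K → (V →ₗ[K] Mo)) (hj : Fin s → Idx K),
    (∀ j, Kbar K (hj j)) ∧
    (∀ j b, InLat2 K Mo (fun kw mx => d j kw mx b)) ∧
    (∀ b (m k : Idx K),
      lhsXW K V Mo YM a (fun k' => YM b k' cM) m k =
        ∑ j, xwPow K Mo (-(hj j)) (fun kw mx => d j kw mx b) m k) ∧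
    (∀ b (m k : Idx K),
      YM (Y a m b) k cM =
        ∑ j, wxPow K Mo (-(hj j)) (fun kw mx => d j kw mx b) m k)

/-- a and b are dual in the exchange channel on the module -/
def DualExch (Y : V → EDist1 K V) (YM : V → EDist1 K Mo) (a b : V) : Prop :=
  ∃ (r : ℕ) (hab : Fin r → Idx K), (∀ i, Kbar K (hab i)) ∧
    ∀ cM : Mo, ∃ (s : ℕ) (hac : Fin s → Idx K)
      (q : Fin r → Fin s → Idx K → Idx K → Mo),
      (∀ j, Kbar K (hac j)) ∧
      (∀ i j kw mx, q i j kw mx ≠ 0 → IsNegInt K mx.1 ∧ IsNegInt K mx.2) ∧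
      (∀ i j mx, InLat1 K Mo (fun kw => q i j kw mx)) ∧
      (∀ m k : Idx K,
        lhsXW K V Mo YM a (fun k' => YM b k' cM) m k =
          ∑ j, xwPow K Mo (-(hac j))
            (fun kw mx => ∑ i, q i j kw (mx.1 - (hab i).1, mx.2 - (hab i).2)) m k) ∧
      (∀ m k : Idx K,
        YM (Y a m b) k cM =
          ∑ j, wxPow K Mo (-(hac j))
            (fun kw mx => ∑ i, q i j kw (mx.1 - (hab i).1, mx.2 - (hab i).2)) m k)

/-- the module with state-field map YM is dual -/
def IsDualMod (ev od : Submodule K V) (Y : V → EDist1 K V) (YM : V → EDist1 K Mo) : Prop :=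
  ∃ (rVV : V → V → ℕ) (hVV : ∀ a b : V, Fin (rVV a b) → Idx K)
    (rVM : V → Mo → ℕ) (hVM : ∀ (a : V) (c : Mo), Fin (rVM a c) → Idx K),
    (∀ a b i, Kbar K (hVV a b i)) ∧ (∀ a c j, Kbar K (hVM a c j)) ∧
    ∀ a b pa pb, memPar K ev od a pa → memPar K ev od b pb → ∀ c : Mo,
      ∃ p : Fin (rVV a b) → Fin (rVM a c) → Fin (rVM b c) → Dist2 K Mo,
        (∀ i j k, IsPow2 K Mo (p i j k)) ∧
        (∀ m k : Idx K,
          lhsXW K V Mo YM a (fun k' => YM b k' c) m k =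
            ∑ i, ∑ j, ∑ kk, tripleXW K Mo (-(hVV a b i)) (-(hVM b c kk))
              (-(hVM a c j)) (p i j kk) m k) ∧
        (∀ m k : Idx K,
          YM (Y a m b) k c =
            ∑ i, ∑ j, ∑ kk, tripleWX K Mo (-(hVV a b i)) (-(hVM b c kk))
              (-(hVM a c j)) (p i j kk) m k)

/-- F_Y is multiply local -/
def MultLocalAlg (A : OPEAlg K V) : Prop :=
  ∀ (r : ℕ) (f : Fin r → V) (pf : Fin r → ZMod 2),
    (∀ i, memPar K A.ev A.od (f i) (pf i)) →
      MultiplyLocal K V (fun i => A.Y (f i)) pf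

/-- F_Y is uniformly local -/
def UnifLocalAlg (A : OPEAlg K V) : Prop :=
  ∃ (rr : V → V → ℕ) (hh : ∀ a b : V, Fin (rr a b) → Idx K),
    ∀ (r : ℕ) (f : Fin r → V) (pf : Fin r → ZMod 2),
      (∀ i, memPar K A.ev A.od (f i) (pf i)) →
        ∃ c, IsMultOPE K V (fun i => A.Y (f i)) pf (fun i j => rr (f i) (f j))
            (fun i j => hh (f i) (f j)) c ∧
          ∀ α, IsPowN K V (evN K V (c α) A.one)

end OPEA
namespace OPEA

open Finset in
/-- Dedekind-type independence: units `f α` satisfying first-order equations `ℓ f' = ρ f` over `R`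
are linearly independent over `R` unless a quotient of two of them can be a quotient of elements
of `R`. -/
theorem eq_zero_of_sum_mul_eq_zero {k R P ι : Type*} [CommRing k] [CommRing R] [Algebra k R]
    [CommRing P] [Algebra k P] [Fintype ι] (θ : R →+* P)
    (hθ : Function.Injective θ) (d : Derivation k R R) (D : Derivation k P P)
    (hD : ∀ a, D (θ a) = θ (d a)) (f : ι → P) (hf : ∀ α, IsUnit (f α)) (l : R) (ρ : ι → R)
    (hρ : ∀ α, θ l * D (f α) = θ (ρ α) * f α)
    (hno : ∀ α β, α ≠ β → ∀ a b, a ≠ 0 → b ≠ 0 →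
      l * (b * d a - a * d b) ≠ (ρ β - ρ α) * (a * b))
    (c : ι → R) (hc : ∑ α, θ (c α) * f α = 0) : c = 0 := by
  induction hn : #{α | c α ≠ 0} using Nat.strong_induction_on generalizing c with
  | _ n ih =>
  subst hn
  by_contra hne
  obtain ⟨β, hβ⟩ : ∃ β, c β ≠ 0 := by
    by_contra! h
    exact hne (funext h)
  have hder : ∑ α, θ (l * d (c α) + ρ α * c α) * f α = 0 := by
    have h := congrArg (fun x => θ l * D x) hc
    simp only [map_sum, Derivation.leibniz, smul_eq_mul, map_zero, mul_zero, mul_sum, hD] at h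
    rw [← h]
    refine sum_congr rfl fun α _ => ?_
    simp only [map_add, map_mul]
    linear_combination (- θ (c α)) * hρ α
  have hnew := ih _ ?_ (fun α => c β * (l * d (c α) + ρ α * c α)
      - c α * (l * d (c β) + ρ β * c β)) ?_ rfl
  · have honly : ∀ α, α ≠ β → c α = 0 := by
      intro α hα
      by_contra hcα
      refine hno α β hα (c α) (c β) hcα hβ ?_
      have := congrFun hnew α
      simp only [Pi.zero_apply] at this
      linear_combination this
    rw [sum_eq_single β (fun α _ hα => by simp [honly α hα]) (by simp)] at hc
    refine hβ (hθ ?_)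
    rw [map_zero]
    exact (hf β).mul_left_eq_zero.1 hc
  · refine card_lt_card ?_
    refine (ssubset_iff_of_subset fun α => ?_).2 ⟨β, by simpa using hβ, by simp⟩
    simp only [mem_filter, mem_univ, true_and]
    intro h h0
    simp [h0] at h
  · have : ∀ α, θ (c β * (l * d (c α) + ρ α * c α) - c α * (l * d (c β) + ρ β * c β)) * f α
        = θ (c β) * (θ (l * d (c α) + ρ α * c α) * f α)
          - θ (l * d (c β) + ρ β * c β) * (θ (c α) * f α) := by
      intro α
      simp only [map_sub, map_mul]
      ring
    simp only [this, sum_sub_distrib, ← mul_sum, hder, hc, mul_zero, sub_zero]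

open Finset in
/-- If a combination of logarithmic derivatives of pairwise coprime primes is the logarithmic
derivative of a quotient, its coefficients are integers. -/
theorem exists_int_of_logDeriv_eq {k R I : Type*} [Field k] [CommRing R] [IsDomain R]
    [UniqueFactorizationMonoid R] [Algebra k R] [Fintype I] [DecidableEq I]
    (d : Derivation k R R) (l s : I → R) (hl : ∀ q, Prime (l q))
    (hdvd : ∀ q q', q' ≠ q → ¬ l q ∣ l q') (hs : ∀ q, l q ∣ d (l q) - s q)
    (hs' : ∀ q, ¬ l q ∣ s q) (η : I → k) {a b : R} (ha : a ≠ 0) (hb : b ≠ 0)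
    (h : (∏ q, l q) * (b * d a - a * d b)
      = (∑ q, algebraMap k R (η q) * s q * ∏ q' ∈ univ.erase q, l q') * (a * b)) (p : I) :
    ∃ n : ℤ, (n : k) = η p := by
  obtain ⟨u, hu, hu'⟩ :=
    (FiniteMultiplicity.of_prime_left (hl p) ha).exists_eq_pow_mul_and_not_dvd
  obtain ⟨v, hv, hv'⟩ :=
    (FiniteMultiplicity.of_prime_left (hl p) hb).exists_eq_pow_mul_and_not_dvd
  generalize multiplicity (l p) a = m at hu
  generalize multiplicity (l p) b = n at hv
  obtain ⟨w, hw⟩ := hs p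
  set M := ∏ q ∈ univ.erase p, l q with hM
  have hprod : ∏ q, l q = l p * M := (mul_prod_erase _ _ (mem_univ p)).symm
  obtain ⟨t, ht⟩ : l p ∣ ∑ q ∈ univ.erase p,
      algebraMap k R (η q) * s q * ∏ q' ∈ univ.erase q, l q' := by
    refine dvd_sum fun q hq => Dvd.dvd.mul_left (dvd_prod_of_mem _ ?_) _
    simp only [mem_erase, mem_univ, and_true] at hq ⊢
    exact Ne.symm hq
  rw [← add_sum_erase _ _ (mem_univ p), ht, hprod] at h
  have hpow : ∀ j : ℕ, l p * d (l p ^ j) = j * l p ^ j * d (l p) := by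
    intro j
    rcases j with _ | j
    · simp
    · rw [Derivation.leibniz_pow]
      simp only [Nat.add_sub_cancel, nsmul_eq_mul, smul_eq_mul]
      ring
  have hda : l p * d a = l p ^ m * (m * d (l p) * u + l p * d u) := by
    rw [hu, Derivation.leibniz]
    simp only [smul_eq_mul]
    linear_combination u * hpow m
  have hdb : l p * d b = l p ^ n * (n * d (l p) * v + l p * d v) := by
    rw [hv, Derivation.leibniz]
    simp only [smul_eq_mul]
    linear_combination v * hpow n
  have hdl : d (l p) = s p + l p * w := by linear_combination hw
  have key : l p ^ (m + n) * (M * (v * (m * d (l p) * u + l p * d u)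
        - u * (n * d (l p) * v + l p * d v)))
      = l p ^ (m + n) * ((algebraMap k R (η p) * s p * M + l p * t) * (u * v)) := by
    rw [← hM] at h
    have e : (algebraMap k R (η p) * s p * M + l p * t) * (a * b) =
        l p ^ (m + n) * ((algebraMap k R (η p) * s p * M + l p * t) * (u * v)) := by
      rw [hu, hv]; ring
    rw [← e, ← h]
    have e2 : l p * M * (b * d a - a * d b) = M * (b * (l p * d a) - a * (l p * d b)) := by ring
    rw [e2, hda, hdb]
    conv_rhs => rw [hu, hv]
    ring
  have key' := mul_left_cancel₀ (pow_ne_zero _ (hl p).ne_zero) key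
  refine ⟨m - n, ?_⟩
  by_contra hne
  have hdiv : l p ∣ algebraMap k R (((m - n : ℤ) : k) - η p) * (s p * M * (u * v)) := by
    refine ⟨t * (u * v) - M * (v * (m * w * u + d u) - u * (n * w * v + d v)), ?_⟩
    rw [hdl] at key'
    simp only [map_sub, Int.cast_sub, Int.cast_natCast, map_natCast]
    linear_combination key'
  have hunit : IsUnit (algebraMap k R (((m - n : ℤ) : k) - η p)) :=
    (IsUnit.mk0 _ (sub_ne_zero.2 hne)).map _
  rw [hunit.dvd_mul_left] at hdiv
  rcases (hl p).dvd_or_dvd hdiv with h1 | h1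
  · rcases (hl p).dvd_or_dvd h1 with h2 | h2
    · exact hs' p h2
    · obtain ⟨q, hq, hq'⟩ := (hl p).exists_mem_finset_dvd h2
      exact hdvd p q (ne_of_mem_erase hq) hq'
  · rcases (hl p).dvd_or_dvd h1 with h2 | h2
    exacts [hu' h2, hv' h2]

open Finset in
theorem prod_mul_derivation_prod {k P I : Type*} [CommRing k] [CommRing P] [Algebra k P]
    [DecidableEq I] (D : Derivation k P P) (S : Finset I) (l f g : I → P)
    (h : ∀ q ∈ S, l q * D (f q) = g q * f q) :
    (∏ q ∈ S, l q) * D (∏ q ∈ S, f q)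
      = (∑ q ∈ S, g q * ∏ q' ∈ S.erase q, l q') * ∏ q ∈ S, f q := by
  induction S using Finset.induction_on with
  | empty => simp
  | insert p S hp ih =>
    have ih := ih fun q hq => h q (mem_insert_of_mem hq)
    have hp' := h p (mem_insert_self _ _)
    have hsum : ∑ q ∈ S, g q * ∏ q' ∈ (insert p S).erase q, l q'
        = l p * ∑ q ∈ S, g q * ∏ q' ∈ S.erase q, l q' := by
      rw [mul_sum]
      refine sum_congr rfl fun q hq => ?_
      rw [erase_insert_of_ne (by rintro rfl; exact hp hq), prod_insert (by simp [hp])]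
      ring
    rw [prod_insert hp, prod_insert hp, sum_insert hp, erase_insert hp, hsum, Derivation.leibniz]
    simp only [smul_eq_mul]
    linear_combination (∏ q ∈ S, l q) * (∏ q ∈ S, f q) * hp' + l p * f p * ih

theorem prime_X_sub_X {k σ : Type*} [Field k] {i j : σ} (hij : i ≠ j) :
    Prime (MvPolynomial.X i - MvPolynomial.X j : MvPolynomial σ k) := by
  refine Irreducible.prime (MvPolynomial.irreducible_of_totalDegree_eq_one ?_ ?_)
  · refine le_antisymm ?_ ?_
    · refine (MvPolynomial.totalDegree_sub _ _).trans ?_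
      simp
    · have h : MvPolynomial.coeff (Finsupp.single i 1)
          (MvPolynomial.X i - MvPolynomial.X j : MvPolynomial σ k) ≠ 0 := by
        simp [MvPolynomial.coeff_X, Finsupp.single_left_inj, hij.symm]
      simpa using MvPolynomial.le_totalDegree (MvPolynomial.mem_support_iff.2 h)
  · intro x hx
    have h := hx (Finsupp.single i 1)
    simp only [MvPolynomial.coeff_sub, MvPolynomial.coeff_X, Finsupp.single_left_inj one_ne_zero,
      hij.symm, if_true, if_false, sub_zero] at h
    exact isUnit_of_dvd_one h

theorem eq_of_X_sub_X_dvd {k σ : Type*} [Field k] {i j : σ} {f : MvPolynomial σ k}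
    (h : MvPolynomial.X i - MvPolynomial.X j ∣ f) {x : σ → k} (hx : x i = x j) :
    MvPolynomial.eval x f = 0 := by
  obtain ⟨g, rfl⟩ := h
  simp [hx]

section BinomialSeries

open PowerSeries

variable (K : Type*) [Field K] {A : Type*} [CommRing A] [Algebra K A]

theorem gchoose_zero (h : K) : gchoose K h 0 = 1 := by simp [gchoose]

theorem gchoose_succ_mul [CharZero K] (h : K) (k : ℕ) :
    gchoose K h (k + 1) * (k + 1) = gchoose K h k * (h - k) := by
  have h1 : (k.factorial : K) ≠ 0 := Nat.cast_ne_zero.2 k.factorial_ne_zero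
  have h2 : (k + 1 : K) ≠ 0 := by exact_mod_cast k.succ_ne_zero
  simp only [gchoose, Finset.prod_range_succ, Nat.factorial_succ, Nat.cast_mul, Nat.cast_succ]
  field_simp

variable (A) in
/-- the power series of `(1 - X) ^ h` -/
def oneSubPow (h : K) : A⟦X⟧ := mk fun k => algebraMap K A ((-1) ^ k * gchoose K h k)

theorem one_sub_X_mul_derivative_oneSubPow [CharZero K] (h : K) :
    (1 - X) * derivative A (oneSubPow K A h) = - (C (algebraMap K A h) * oneSubPow K A h) := by
  ext n
  have e : ∀ n, coeff n (derivative A (oneSubPow K A h))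
      = algebraMap K A ((-1) ^ (n + 1) * (gchoose K h n * (h - n))) := by
    intro n
    rw [coeff_derivative, oneSubPow, coeff_mk, ← gchoose_succ_mul]
    simp only [map_mul, map_add, map_natCast, map_one]
    ring
  rw [sub_mul, one_mul, map_sub, map_neg, coeff_C_mul, e]
  rcases n with _ | n
  · simp [oneSubPow, mul_comm]
  · rw [coeff_succ_X_mul, e, oneSubPow, coeff_mk, ← gchoose_succ_mul K h n, ← map_sub, ← map_mul,
      ← map_neg]
    congr 1
    push_cast
    ring

theorem isUnit_oneSubPow_subst (h : K) {u : A⟦X⟧} (hu : constantCoeff u = 0) :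
    IsUnit ((oneSubPow K A h).subst u) := by
  have hs : HasSubst u := HasSubst.of_constantCoeff_zero' hu
  have h1 : IsUnit (oneSubPow K A h) := by
    rw [isUnit_iff_constantCoeff, ← coeff_zero_eq_constantCoeff_apply, oneSubPow, coeff_mk]
    simp [gchoose_zero]
  have := h1.map (substAlgHom (R := A) hs)
  rwa [coe_substAlgHom] at this

theorem one_sub_mul_derivative_oneSubPow_subst [CharZero K] (h : K) {u : A⟦X⟧}
    (hu : constantCoeff u = 0) :
    (1 - u) * derivative A ((oneSubPow K A h).subst u)
      = - (C (algebraMap K A h) * derivative A u * (oneSubPow K A h).subst u) := by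
  have hs : HasSubst u := HasSubst.of_constantCoeff_zero' hu
  have := congrArg (substAlgHom (R := A) hs) (one_sub_X_mul_derivative_oneSubPow K (A := A) h)
  have hC : substAlgHom (R := A) hs (C (algebraMap K A h)) = C (algebraMap K A h) := by
    exact (substAlgHom (R := A) hs).commutes _
  have hX : substAlgHom (R := A) hs X = u := substAlgHom_X hs
  rw [map_mul, map_neg, map_mul, map_sub, map_one, hC, hX, coe_substAlgHom] at this
  rw [derivative_subst hs]
  linear_combination derivative A u * this

theorem X_pow_dvd_subst_sub_sum (f : A⟦X⟧) {u : A⟦X⟧} (hu : constantCoeff u = 0)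
    (N : ℕ) : X ^ N ∣ f.subst u - ∑ k ∈ Finset.range N, C (coeff k f) * u ^ k := by
  have hs : HasSubst u := HasSubst.of_constantCoeff_zero' hu
  have hX : substAlgHom (R := A) hs X = u := substAlgHom_X hs
  obtain ⟨g, hg⟩ : X ^ N ∣ f - ∑ k ∈ Finset.range N, C (coeff k f) * X ^ k := by
    rw [X_pow_dvd_iff]
    intro m hm
    simp [coeff_X_pow, coeff_C_mul, hm]
  have h2 := congrArg (substAlgHom (R := A) hs) hg
  have hC : ∀ a : A, substAlgHom (R := A) hs (C a) = C a := (substAlgHom (R := A) hs).commutes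
  simp only [map_sub, map_sum, map_mul, map_pow, hX, hC] at h2
  rw [coe_substAlgHom] at h2
  rw [h2]
  exact (pow_dvd_pow_of_dvd (X_dvd_iff.2 hu) N).mul_right _

theorem X_pow_dvd_oneSubPow_subst_sub (h : K) {u : A⟦X⟧} (hu : constantCoeff u = 0) (N : ℕ) :
    X ^ N ∣ (oneSubPow K A h).subst u
      - ∑ k ∈ Finset.range N, ((-1 : K) ^ k * gchoose K h k) • u ^ k := by
  convert X_pow_dvd_subst_sub_sum (oneSubPow K A h) hu N using 3 with k hk
  rw [oneSubPow, coeff_mk, Algebra.smul_def]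
  rw [PowerSeries.algebraMap_apply]

end BinomialSeries

section Laurent

open PowerSeries

variable (K : Type*) [Field K] {r : ℕ}

/-- the Laurent monomial with exponent `g`, placed in degree `n` of the auxiliary grading -/
def mon (g : Fin r × Bool → ℤ) (n : ℕ) : (AddMonoidAlgebra K (Fin r × Bool → ℤ))⟦X⟧ :=
  monomial n (AddMonoidAlgebra.single g 1)

theorem mon_mul_mon (g g' : Fin r × Bool → ℤ) (n n' : ℕ) :
    mon K g n * mon K g' n' = mon K (g + g') (n + n') := by
  simp [mon, monomial_mul_monomial, AddMonoidAlgebra.single_mul_single]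

theorem mon_zero : mon K (0 : Fin r × Bool → ℤ) 0 = 1 := by
  rw [mon, ← AddMonoidAlgebra.one_def, monomial_zero_eq_C_apply, map_one]

theorem mon_pow (g : Fin r × Bool → ℤ) (n k : ℕ) : mon K g n ^ k = mon K (k • g) (k * n) := by
  induction k with
  | zero => simp [mon_zero]
  | succ k ih => rw [pow_succ, ih, mon_mul_mon, succ_nsmul, Nat.succ_mul]

theorem prod_mon {ι : Type*} (s : Finset ι) (g : ι → Fin r × Bool → ℤ) (n : ι → ℕ) :
    ∏ i ∈ s, mon K (g i) (n i) = mon K (∑ i ∈ s, g i) (∑ i ∈ s, n i) := by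
  induction s using Finset.induction_on with
  | empty => simp [mon_zero]
  | insert i s hi ih => simp only [Finset.prod_insert hi, Finset.sum_insert hi, ih, mon_mul_mon]

theorem constantCoeff_mon (g : Fin r × Bool → ℤ) {n : ℕ} (hn : n ≠ 0) :
    constantCoeff (mon K g n) = 0 := by
  rw [← coeff_zero_eq_constantCoeff_apply, mon, coeff_monomial, if_neg hn.symm]

theorem coeff_coeff_mon (g g' : Fin r × Bool → ℤ) (n n' : ℕ) :
    (coeff n (mon K g' n')).coeff g = if n' = n ∧ g' = g then 1 else 0 := by
  rw [mon, coeff_monomial]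
  by_cases h : n = n' <;> simp [h, Finsupp.single_apply, eq_comm]

/-- the Euler derivation of the auxiliary grading -/
def eulerSeries (r : ℕ) : Derivation K (AddMonoidAlgebra K (Fin r × Bool → ℤ))⟦X⟧
    (AddMonoidAlgebra K (Fin r × Bool → ℤ))⟦X⟧ :=
  (X : (AddMonoidAlgebra K (Fin r × Bool → ℤ))⟦X⟧) •
    (derivative (AddMonoidAlgebra K (Fin r × Bool → ℤ))).restrictScalars K

theorem eulerSeries_apply (f : (AddMonoidAlgebra K (Fin r × Bool → ℤ))⟦X⟧) :
    eulerSeries K r f = X * derivative _ f := rfl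

theorem eulerSeries_mon (g : Fin r × Bool → ℤ) (n : ℕ) :
    eulerSeries K r (mon K g n) = n * mon K g n := by
  rw [eulerSeries_apply]
  ext1 m
  rw [show (n : (AddMonoidAlgebra K (Fin r × Bool → ℤ))⟦X⟧) = C (n : AddMonoidAlgebra K _) by simp,
    coeff_C_mul]
  rcases m with _ | m
  · simp only [coeff_zero_X_mul, mon, coeff_monomial]
    split_ifs with h
    · simp [← h]
    · simp
  · rw [coeff_succ_X_mul, coeff_derivative, mon, coeff_monomial]
    split_ifs with h
    · rw [← h]
      push_cast
      ring
    · simp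

variable (r) in
/-- polynomials as graded Laurent series -/
def toSeries : MvPolynomial (Fin r × Bool) K →ₐ[K] (AddMonoidAlgebra K (Fin r × Bool → ℤ))⟦X⟧ :=
  MvPolynomial.aeval fun x => mon K (Pi.single x 1) x.1

theorem toSeries_X (x : Fin r × Bool) :
    toSeries K r (MvPolynomial.X x) = mon K (Pi.single x 1) x.1 := by
  simp [toSeries]

theorem toSeries_monomial (e : Fin r × Bool →₀ ℕ) (a : K) :
    toSeries K r (MvPolynomial.monomial e a)
      = a • mon K (fun x => (e x : ℤ)) (∑ x, e x * (x.1 : ℕ)) := by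
  rw [toSeries, MvPolynomial.aeval_monomial, Algebra.smul_def,
    Finsupp.prod_fintype _ _ (fun _ => pow_zero _)]
  simp only [mon_pow, prod_mon]
  congr 2
  ext x
  simp [Finset.sum_apply, Pi.single_apply]

/-- the weight of an exponent in the auxiliary grading -/
def weight (r : ℕ) : (Fin r × Bool → ℤ) →+ ℤ where
  toFun g := ∑ x, g x * ((x.1 : ℕ) : ℤ)
  map_zero' := by simp
  map_add' g g' := by simp [add_mul, Finset.sum_add_distrib]

theorem weight_apply (g : Fin r × Bool → ℤ) : weight r g = ∑ x, g x * ((x.1 : ℕ) : ℤ) := rfl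

theorem coeff_coeff_mon_mul_toSeries (c : MvPolynomial (Fin r × Bool) K)
    (F : (Fin r × Bool → ℤ) → K) (hF : ∀ e : Fin r × Bool →₀ ℕ, c.coeff e = F fun x => (e x : ℤ))
    (hF0 : ∀ g, F g ≠ 0 → ∀ x, 0 ≤ g x) (g v : Fin r × Bool → ℤ) (n k : ℕ)
    (hv : weight r v = k) (hg : weight r g = n) :
    (coeff n (mon K v k * toSeries K r c)).coeff g = F (g - v) := by
  conv_lhs => rw [c.as_sum]
  simp only [map_sum, Finset.mul_sum, toSeries_monomial, mul_smul_comm, mon_mul_mon,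
    LinearMap.map_smul_of_tower, AddMonoidAlgebra.coeff_sum, AddMonoidAlgebra.coeff_smul,
    Finsupp.finsetSum_apply, Finsupp.smul_apply, coeff_coeff_mon, smul_eq_mul]
  have hcond : ∀ e : Fin r × Bool →₀ ℕ,
      (k + ∑ x, e x * (x.1 : ℕ) = n ∧ (v + fun x => (e x : ℤ)) = g)
        ↔ (fun x => (e x : ℤ)) = g - v := by
    intro e
    constructor
    · rintro ⟨-, h⟩
      rw [← h]; simp
    · intro h
      have h' : (v + fun x => (e x : ℤ)) = g := by rw [h]; simp
      refine ⟨?_, h'⟩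
      have h2 := congrArg (weight r) h'
      rw [map_add, hv, hg, weight_apply] at h2
      exact_mod_cast h2
  simp only [hcond]
  by_cases h0 : F (g - v) = 0
  · rw [h0]
    refine Finset.sum_eq_zero fun e _ => ?_
    split_ifs with h
    · rw [hF, h, h0, zero_mul]
    · rw [mul_zero]
  · have hpos := hF0 _ h0
    let e : Fin r × Bool →₀ ℕ := Finsupp.equivFunOnFinite.symm fun x => ((g - v) x).toNat
    have he : (fun x => (e x : ℤ)) = g - v := by
      ext x
      exact Int.toNat_of_nonneg (hpos x)
    rw [Finset.sum_eq_single e]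
    · rw [if_pos he, hF, he, mul_one]
    · intro e' _ hne
      rw [if_neg, mul_zero]
      intro h
      refine hne (Finsupp.ext fun x => ?_)
      exact_mod_cast congrFun (h.trans he.symm) x
    · intro h
      rw [MvPolynomial.notMem_support_iff.1 h, zero_mul]

theorem coeff_coeff_eq_zero_of_weight_ne (c : MvPolynomial (Fin r × Bool) K)
    (g v : Fin r × Bool → ℤ) (n k : ℕ) (hv : weight r v = k) (hg : weight r g ≠ n) :
    (coeff n (mon K v k * toSeries K r c)).coeff g = 0 := by
  conv_lhs => rw [c.as_sum]
  simp only [map_sum, Finset.mul_sum, toSeries_monomial, mul_smul_comm, mon_mul_mon,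
    LinearMap.map_smul_of_tower, AddMonoidAlgebra.coeff_sum, AddMonoidAlgebra.coeff_smul,
    Finsupp.finsetSum_apply, Finsupp.smul_apply, coeff_coeff_mon, smul_eq_mul]
  refine Finset.sum_eq_zero fun e _ => ?_
  rw [if_neg, mul_zero]
  rintro ⟨h1, rfl⟩
  refine hg ?_
  rw [map_add, hv, weight_apply, ← h1]
  push_cast
  rfl

theorem toSeries_injective : Function.Injective (toSeries K r) := by
  rw [injective_iff_map_eq_zero]
  intro c hc
  let F : (Fin r × Bool → ℤ) → K := fun g => if ∀ x, 0 ≤ g x then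
    c.coeff (Finsupp.equivFunOnFinite.symm fun x => (g x).toNat) else 0
  ext e
  have h := coeff_coeff_mon_mul_toSeries K c F (fun e' => ?_) (fun g hg => ?_)
    (fun x => (e x : ℤ)) 0 (∑ x, e x * (x.1 : ℕ)) 0 (by simp) (by simp [weight_apply])
  · rw [hc, mul_zero, sub_zero] at h
    simp only [F, Nat.cast_nonneg, implies_true, if_true, Int.toNat_natCast] at h
    rw [MvPolynomial.coeff_zero, show e = Finsupp.equivFunOnFinite.symm fun x => e x from
      Finsupp.ext fun _ => rfl, ← h]
    simp
  · simp only [F, Nat.cast_nonneg, implies_true, if_true, Int.toNat_natCast]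
    congr 1
    exact Finsupp.ext fun _ => rfl
  · by_contra hx
    exact hg (if_neg hx)

variable (r) in
/-- the Euler derivation of the auxiliary grading on polynomials -/
def eulerPoly : Derivation K (MvPolynomial (Fin r × Bool) K) (MvPolynomial (Fin r × Bool) K) :=
  MvPolynomial.mkDerivation K fun x => ((x.1 : ℕ) : MvPolynomial (Fin r × Bool) K) *
    MvPolynomial.X x

theorem eulerPoly_X (x : Fin r × Bool) : eulerPoly K r (MvPolynomial.X x)
    = ((x.1 : ℕ) : MvPolynomial (Fin r × Bool) K) * MvPolynomial.X x := by
  simp [eulerPoly]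

theorem eulerSeries_toSeries (c : MvPolynomial (Fin r × Bool) K) :
    eulerSeries K r (toSeries K r c) = toSeries K r (eulerPoly K r c) := by
  induction c using MvPolynomial.induction_on with
  | C a =>
    rw [show (MvPolynomial.C a : MvPolynomial (Fin r × Bool) K) = algebraMap K _ a from rfl,
      AlgHom.commutes, Derivation.map_algebraMap, Derivation.map_algebraMap, map_zero]
  | add p q hp hq => simp only [map_add, hp, hq]
  | mul_X p x hp =>
    simp only [map_mul, Derivation.leibniz, smul_eq_mul, map_add, hp, eulerPoly_X, toSeries_X,
      eulerSeries_mon, map_natCast]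

/-- the exponent of `z_j / z_i` (or of `z̄_j / z̄_i`) for a pair `i < j` -/
def dir (q : Pairs r × Bool) : Fin r × Bool → ℤ :=
  Pi.single (q.1.1.2, q.2) 1 - Pi.single (q.1.1.1, q.2) 1

/-- the degree of `z_j / z_i` in the auxiliary grading -/
def gap (p : Pairs r) : ℕ := (p.1.2 : ℕ) - (p.1.1 : ℕ)

theorem gap_pos (p : Pairs r) : 0 < gap p := Nat.sub_pos_of_lt p.2

theorem weight_dir (q : Pairs r × Bool) : weight r (dir q) = gap q.1 := by
  have : (q.1.1.1 : ℕ) ≤ q.1.1.2 := q.1.2.le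
  rw [gap, Nat.cast_sub this, dir, map_sub]
  simp [weight_apply, Pi.single_apply]

theorem constantCoeff_mon_dir (q : Pairs r × Bool) :
    constantCoeff (mon K (dir q) (gap q.1)) = 0 :=
  constantCoeff_mon K _ (gap_pos q.1).ne'

/-- the series `(1 - z_j / z_i) ^ h` -/
def factor (h : K) (q : Pairs r × Bool) : (AddMonoidAlgebra K (Fin r × Bool → ℤ))⟦X⟧ :=
  (oneSubPow K (AddMonoidAlgebra K (Fin r × Bool → ℤ)) h).subst (mon K (dir q) (gap q.1))

theorem isUnit_factor (h : K) (q : Pairs r × Bool) : IsUnit (factor K h q) :=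
  isUnit_oneSubPow_subst K h (constantCoeff_mon_dir K q)

variable (r) in
/-- the linear form `z_i - z_j` -/
def linForm (q : Pairs r × Bool) : MvPolynomial (Fin r × Bool) K :=
  MvPolynomial.X (q.1.1.1, q.2) - MvPolynomial.X (q.1.1.2, q.2)

variable (r) in
/-- the residue of the Euler derivative of `z_i - z_j` on the diagonal -/
def linRes (q : Pairs r × Bool) : MvPolynomial (Fin r × Bool) K :=
  MvPolynomial.C (((q.1.1.1 : ℕ) : K) - ((q.1.1.2 : ℕ) : K)) * MvPolynomial.X (q.1.1.2, q.2)

theorem toSeries_linForm_mul_eulerSeries_factor [CharZero K] (h : K) (q : Pairs r × Bool) :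
    toSeries K r (linForm K r q) * eulerSeries K r (factor K h q)
      = toSeries K r (MvPolynomial.C h * linRes K r q) * factor K h q := by
  have hle : (q.1.1.1 : ℕ) ≤ q.1.1.2 := q.1.2.le
  set u := mon K (dir q) (gap q.1) with hu
  set z := mon K (Pi.single (q.1.1.1, q.2) (1 : ℤ)) (q.1.1.1 : ℕ) with hz
  have hzu : mon K (Pi.single (q.1.1.2, q.2) (1 : ℤ)) (q.1.1.2 : ℕ) = z * u := by
    rw [hz, hu, mon_mul_mon, dir, gap]
    congr 1
    · simp
    · omega
  have h1 := one_sub_mul_derivative_oneSubPow_subst K h (constantCoeff_mon_dir K q)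
  have h2 := eulerSeries_mon K (dir q) (gap q.1)
  rw [← hu] at h1 h2
  rw [eulerSeries_apply] at h2
  have hC : C (algebraMap K (AddMonoidAlgebra K (Fin r × Bool → ℤ)) h) =
      algebraMap K (AddMonoidAlgebra K (Fin r × Bool → ℤ))⟦X⟧ h :=
    PowerSeries.algebraMap_apply.symm
  have hres : toSeries K r (linRes K r q)
      = - ((gap q.1 : ℕ) : (AddMonoidAlgebra K (Fin r × Bool → ℤ))⟦X⟧) * (z * u) := by
    rw [linRes, map_mul, toSeries_X, hzu, gap, Nat.cast_sub hle]
    simp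
  rw [linForm, map_sub, toSeries_X, toSeries_X, hzu, eulerSeries_apply, map_mul, hres,
    ← MvPolynomial.algebraMap_eq, AlgHom.commutes, ← hC, factor, ← hu]
  linear_combination z * X * h1 -
    z * C (algebraMap K (AddMonoidAlgebra K (Fin r × Bool → ℤ)) h) *
      (oneSubPow K (AddMonoidAlgebra K (Fin r × Bool → ℤ)) h).subst u * h2

theorem prime_linForm (q : Pairs r × Bool) : Prime (linForm K r q) :=
  prime_X_sub_X fun h => q.1.2.ne (congrArg Prod.fst h)

theorem not_linForm_dvd_linForm [CharZero K] (q q' : Pairs r × Bool) (hne : q' ≠ q) :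
    ¬ linForm K r q ∣ linForm K r q' := by
  intro h
  obtain ⟨⟨⟨i, j⟩, hij⟩, b⟩ := q
  obtain ⟨⟨⟨i', j'⟩, hij'⟩, b'⟩ := q'
  simp only at hij hij'
  have h1 := eq_of_X_sub_X_dvd h (x := fun x => if x = (i, b) ∨ x = (j, b) then 0
    else if x = (i', b') then 1 else 2) (by simp)
  simp only [linForm, map_sub, MvPolynomial.eval_X] at h1
  have hne2 : ((i', b') : Fin r × Bool) ≠ (j', b') := fun h => hij'.ne (congrArg Prod.fst h)
  by_cases h2 : ((i', b') = (i, b) ∨ (i', b') = (j, b)) <;>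
    by_cases h3 : ((j', b') = (i, b) ∨ (j', b') = (j, b))
  · refine hne ?_
    simp only [Prod.mk.injEq] at h2 h3
    have hb : b' = b := by tauto
    subst hb
    simp only [and_true] at h2 h3
    have : i' = i ∧ j' = j := by
      rcases h2 with h2 | h2 <;> rcases h3 with h3 | h3 <;> subst h2 <;> subst h3
      · exact absurd hij' (lt_irrefl _)
      · exact ⟨rfl, rfl⟩
      · exact absurd hij' hij.asymm
      · exact absurd hij' (lt_irrefl _)
    obtain ⟨rfl, rfl⟩ := this
    rfl
  · rw [if_pos h2, if_neg h3, if_neg hne2.symm] at h1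
    norm_num at h1
  · rw [if_neg h2, if_pos trivial, if_pos h3] at h1
    norm_num at h1
  · rw [if_neg h2, if_pos trivial, if_neg h3, if_neg hne2.symm] at h1
    norm_num at h1

theorem linForm_dvd_eulerPoly_sub (q : Pairs r × Bool) :
    linForm K r q ∣ eulerPoly K r (linForm K r q) - linRes K r q := by
  refine ⟨((q.1.1.1 : ℕ) : MvPolynomial (Fin r × Bool) K), ?_⟩
  simp only [linForm, linRes, map_sub, eulerPoly_X, map_natCast]
  ring

theorem not_linForm_dvd_linRes [CharZero K] (q : Pairs r × Bool) :
    ¬ linForm K r q ∣ linRes K r q := by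
  intro h
  have h1 := eq_of_X_sub_X_dvd h (x := fun _ => 1) rfl
  simp only [linRes, map_mul, MvPolynomial.eval_C, MvPolynomial.eval_X, mul_one, sub_eq_zero] at h1
  exact q.1.2.ne (Fin.ext (Nat.cast_injective h1))

/-- Products of powers of the `1 - z_j / z_i` whose exponents are pairwise incongruent modulo
integers are linearly independent over polynomials. -/
theorem eq_zero_of_sum_toSeries_mul_prod_factor [CharZero K] {ι : Type*}
    [Fintype ι] (h : ι → Pairs r × Bool → K)
    (hh : ∀ α β, (∀ q, ∃ n : ℤ, (n : K) = h β q - h α q) → α = β)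
    (c : ι → MvPolynomial (Fin r × Bool) K)
    (hc : ∑ α, toSeries K r (c α) * ∏ q, factor K (h α q) q = 0) : c = 0 := by
  refine eq_zero_of_sum_mul_eq_zero (k := K) (toSeries K r).toRingHom (toSeries_injective K)
    (eulerPoly K r) (eulerSeries K r) (eulerSeries_toSeries K) _ (fun α => ?_)
    (∏ q, linForm K r q) (fun α => ∑ q, MvPolynomial.C (h α q) * linRes K r q *
      ∏ q' ∈ Finset.univ.erase q, linForm K r q') (fun α => ?_) ?_ c hc
  · rw [IsUnit.prod_univ_iff]
    exact fun q => isUnit_factor K (h α q) q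
  · have := prod_mul_derivation_prod (eulerSeries K r) Finset.univ
      (fun q => toSeries K r (linForm K r q)) (fun q => factor K (h α q) q)
      (fun q => toSeries K r (MvPolynomial.C (h α q) * linRes K r q))
      (fun q _ => toSeries_linForm_mul_eulerSeries_factor K (h α q) q)
    simpa only [AlgHom.toRingHom_eq_coe, RingHom.coe_coe, map_prod, map_sum, map_mul] using this
  · intro α β hne a b ha hb heq
    refine hne (hh α β fun q => ?_)
    refine exists_int_of_logDeriv_eq (eulerPoly K r) (linForm K r) (linRes K r)
      (prime_linForm K) (not_linForm_dvd_linForm K) (linForm_dvd_eulerPoly_sub K)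
      (not_linForm_dvd_linRes K) (fun q => h β q - h α q) ha hb ?_ q
    rw [heq]
    simp only [map_sub, sub_mul, Finset.sum_sub_distrib, MvPolynomial.algebraMap_eq]

end Laurent

section Coefficients

open PowerSeries Finset

variable (K : Type*) [Field K] {r : ℕ}

theorem dvd_prod_sub_prod {R I : Type*} [CommRing R] (s : Finset I) (a : R) (f g : I → R)
    (h : ∀ i ∈ s, a ∣ f i - g i) : a ∣ ∏ i ∈ s, f i - ∏ i ∈ s, g i := by
  induction s using Finset.induction_on with
  | empty => simp
  | insert i s hi ih =>
    rw [prod_insert hi, prod_insert hi]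
    exact dvd_mul_sub_mul (h i (mem_insert_self _ _)) (ih fun j hj => h j (mem_insert_of_mem hj))

/-- the exponent of the monomial belonging to `κ` in the expansion of a product of binomials -/
def twist (κ : Pairs r → ℕ × ℕ) : Fin r × Bool → ℤ :=
  ∑ p, ((κ p).1 • dir (p, false) + (κ p).2 • dir (p, true))

/-- the degree of the monomial belonging to `κ` in the auxiliary grading -/
def twistWeight (κ : Pairs r → ℕ × ℕ) : ℕ := ∑ p, ((κ p).1 * gap p + (κ p).2 * gap p)

theorem weight_twist (κ : Pairs r → ℕ × ℕ) : weight r (twist κ) = twistWeight κ := by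
  simp only [twist, twistWeight, map_sum, map_add, map_nsmul, weight_dir]
  simp only [nsmul_eq_mul]
  push_cast
  rfl

theorem le_twistWeight (κ : Pairs r → ℕ × ℕ) (p : Pairs r) :
    (κ p).1 ≤ twistWeight κ ∧ (κ p).2 ≤ twistWeight κ := by
  have h : (κ p).1 * gap p + (κ p).2 * gap p ≤ twistWeight κ :=
    single_le_sum (f := fun p => (κ p).1 * gap p + (κ p).2 * gap p) (fun _ _ => Nat.zero_le _)
      (mem_univ p)
  have h1 := Nat.le_mul_of_pos_right (κ p).1 (gap_pos p)
  have h2 := Nat.le_mul_of_pos_right (κ p).2 (gap_pos p)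
  omega

theorem X_pow_dvd_factor_mul_factor_sub (h : Idx K) (p : Pairs r) (N : ℕ) :
    X ^ N ∣ factor K h.1 (p, false) * factor K h.2 (p, true)
      - ∑ k ∈ range N ×ˢ range N, pairCoef K h false k •
        mon K (k.1 • dir (p, false) + k.2 • dir (p, true)) (k.1 * gap p + k.2 * gap p) := by
  have h1 := X_pow_dvd_oneSubPow_subst_sub K h.1 (constantCoeff_mon_dir K (p, false)) N
  have h2 := X_pow_dvd_oneSubPow_subst_sub K h.2 (constantCoeff_mon_dir K (p, true)) N
  convert dvd_mul_sub_mul h1 h2 using 2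
  · rfl
  rw [sum_product, sum_mul_sum]
  refine sum_congr rfl fun k _ => sum_congr rfl fun l _ => ?_
  rw [mon_pow, mon_pow, smul_mul_smul_comm, mon_mul_mon]
  congr 1
  simp only [pairCoef, pow_add, Bool.false_eq_true, if_false]
  ring

theorem X_pow_dvd_prod_factor_sub (h : Pairs r → Idx K) (N : ℕ) :
    X ^ N ∣ ∏ q : Pairs r × Bool, factor K (if q.2 then (h q.1).2 else (h q.1).1) q
      - ∑ κ ∈ Fintype.piFinset fun _ => range N ×ˢ range N,
        (∏ p, pairCoef K (h p) false (κ p)) • mon K (twist κ) (twistWeight κ) := by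
  convert dvd_prod_sub_prod univ _ _ _
    fun p _ => X_pow_dvd_factor_mul_factor_sub K (h p) p N using 2
  · rw [Fintype.prod_prod_type]
    simp [mul_comm]
  · rw [prod_univ_sum]
    refine sum_congr rfl fun κ _ => ?_
    simp only [Algebra.smul_def, prod_mul_distrib, prod_mon, map_prod]
    rfl

theorem coeff_mul_eq_of_X_pow_dvd {A : Type*} [CommRing A] {n : ℕ} {f g : A⟦X⟧}
    (h : X ^ (n + 1) ∣ f - g) (c : A⟦X⟧) : coeff n (c * f) = coeff n (c * g) := by
  have := X_pow_dvd_iff.1 (h.mul_left c) n n.lt_succ_self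
  rwa [mul_sub, map_sub, sub_eq_zero] at this

theorem coeff_coeff_toSeries_mul_prod_factor (c : MvPolynomial (Fin r × Bool) K)
    (F : (Fin r × Bool → ℤ) → K) (hF : ∀ e : Fin r × Bool →₀ ℕ, c.coeff e = F fun x => (e x : ℤ))
    (hF0 : ∀ g, F g ≠ 0 → ∀ x, 0 ≤ g x) (h : Pairs r → Idx K) (g : Fin r × Bool → ℤ) (n : ℕ) :
    (coeff n (toSeries K r c *
      ∏ q : Pairs r × Bool, factor K (if q.2 then (h q.1).2 else (h q.1).1) q)).coeff g
      = if weight r g = n then ∑ κ ∈ Fintype.piFinset fun _ => range (n + 1) ×ˢ range (n + 1),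
        (∏ p, pairCoef K (h p) false (κ p)) * F (g - twist κ) else 0 := by
  rw [coeff_mul_eq_of_X_pow_dvd (X_pow_dvd_prod_factor_sub K h (n + 1)),
    mul_comm (toSeries K r c), sum_mul]
  simp only [smul_mul_assoc, map_sum, LinearMap.map_smul_of_tower,
    AddMonoidAlgebra.coeff_sum, AddMonoidAlgebra.coeff_smul, Finsupp.finsetSum_apply,
    Finsupp.smul_apply, smul_eq_mul]
  split_ifs with hg
  · exact sum_congr rfl fun κ _ => by
      rw [coeff_coeff_mon_mul_toSeries K c F hF hF0 g _ n _ (weight_twist κ) hg]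
  · exact sum_eq_zero fun κ _ => by
      rw [coeff_coeff_eq_zero_of_weight_ne K c g _ n _ (weight_twist κ) hg, mul_zero]

end Coefficients

section Independence

open Finset

variable {K : Type*} [Field K] {E : Type*} [AddCommGroup E] [Module K E] {r : ℕ}

/-- the index obtained from `b` by multiplication with the Laurent monomial of exponent `-g` -/
def point (b : Fin r → Idx K) (g : Fin r × Bool → ℤ) : Fin r → Idx K :=
  fun i => ((b i).1 - g (i, false), (b i).2 - g (i, true))

/-- the index shift produced by the leading monomial of a product of binomials -/
def headShift (h : Pairs r → Idx K) : Fin r → Idx K := fun i => ∑ p, if i = p.1.1 then h p else 0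

theorem dir_apply (q : Pairs r × Bool) (x : Fin r × Bool) :
    dir q x = (if x = (q.1.1.2, q.2) then 1 else 0) - if x = (q.1.1.1, q.2) then 1 else 0 := by
  simp [dir, Pi.single_apply]

theorem sum_dir (q : Pairs r × Bool) (b : Bool) : ∑ i, dir q (i, b) = 0 := by
  by_cases h : b = q.2 <;> simp [dir_apply, h]

theorem sum_twist (κ : Pairs r → ℕ × ℕ) (b : Bool) : ∑ i, twist κ (i, b) = 0 := by
  simp only [twist, Finset.sum_apply, Pi.add_apply, Pi.smul_apply]
  rw [sum_comm]
  simp only [sum_add_distrib, ← smul_sum, sum_dir, smul_zero, add_zero, sum_const_zero]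

theorem point_add_sum_pairShift [CharZero K] (m : Fin r → Idx K) (h : Pairs r → Idx K)
    (g : Fin r × Bool → ℤ) (κ : Pairs r → ℕ × ℕ) :
    (fun i => point m g i + ∑ p, pairShift K p (h p) false (κ p) i)
      = point (m + headShift h) (g - twist κ) := by
  have hp : ∀ i p, pairShift K p (h p) false (κ p) i = (if i = p.1.1 then h p else 0) +
      (((((κ p).1 • dir (p, false) + (κ p).2 • dir (p, true)) (i, false) : ℤ) : K),
        ((((κ p).1 • dir (p, false) + (κ p).2 • dir (p, true)) (i, true) : ℤ) : K)) := by
    intro i p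
    have hne := p.2.ne
    by_cases h1 : i = p.1.1
    · subst h1
      simp [pairShift, dir_apply, hne, sub_eq_add_neg, Prod.ext_iff]
    · by_cases h2 : i = p.1.2
      · subst h2
        simp [pairShift, dir_apply, hne.symm, Prod.ext_iff]
      · simp [pairShift, dir_apply, h1, h2, Prod.ext_iff]
  ext i <;>
  simp only [hp, sum_add_distrib, point, headShift, twist, Pi.add_apply, Pi.sub_apply,
    Prod.fst_add, Prod.snd_add, Prod.fst_sum, Prod.snd_sum, Finset.sum_apply, Int.cast_sub,
    Int.cast_add, Int.cast_sum] <;>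
  ring

theorem permMul_one_point [CharZero K] (m : Fin r → Idx K) (h : Pairs r → Idx K)
    (g : Fin r × Bool → ℤ) (c : DistN K E r) :
    permMul K E 1 h c (point m g) = ∑ᶠ κ : Pairs r → ℕ × ℕ,
      (∏ p, pairCoef K (h p) false (κ p)) • c (point (m + headShift h) (g - twist κ)) := by
  have hflip : ∀ p : Pairs r, flipOf 1 p = false := fun p =>
    decide_eq_false (not_lt.2 p.2.le)
  simp only [permMul, hflip, point_add_sum_pairShift]

theorem weight_nonneg {g : Fin r × Bool → ℤ} (hg : ∀ x, 0 ≤ g x) : 0 ≤ weight r g :=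
  sum_nonneg fun x _ => mul_nonneg (hg x) (Int.natCast_nonneg _)

theorem permMul_one_point_eq_sum [CharZero K] (m : Fin r → Idx K) (h : Pairs r → Idx K)
    (c : DistN K E r) (hc : ∀ g, c (point (m + headShift h) g) ≠ 0 → ∀ x, 0 ≤ g x)
    (g : Fin r × Bool → ℤ) (n : ℕ) (hg : weight r g = n) :
    permMul K E 1 h c (point m g)
      = ∑ κ ∈ Fintype.piFinset fun _ => range (n + 1) ×ˢ range (n + 1),
        (∏ p, pairCoef K (h p) false (κ p)) • c (point (m + headShift h) (g - twist κ)) := by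
  rw [permMul_one_point]
  refine finsum_eq_sum_of_support_subset _ fun κ hκ => ?_
  have hne : c (point (m + headShift h) (g - twist κ)) ≠ 0 := fun h0 => hκ (by simp [h0])
  have hw := weight_nonneg (hc _ hne)
  rw [map_sub, hg, weight_twist] at hw
  simp only [Fintype.coe_piFinset, coe_product, coe_range, Set.mem_pi, Set.mem_univ, true_imp_iff,
    Set.mem_prod, Set.mem_Iio]
  intro p
  have := le_twistWeight κ p
  omega

/-- The part of given degree of a distribution supported in a translated orthant, as a
polynomial. -/
theorem exists_polynomial (F : (Fin r × Bool → ℤ) → K) (d : Bool → ℤ)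
    (hF : ∀ g, F g ≠ 0 → (∀ x, 0 ≤ g x) ∧ ∀ b, ∑ i, g (i, b) = d b) :
    ∃ c : MvPolynomial (Fin r × Bool) K,
      ∀ e : Fin r × Bool →₀ ℕ, c.coeff e = F fun x => (e x : ℤ) := by
  refine ⟨AddMonoidAlgebra.ofCoeff (Finsupp.onFinset
    (Finset.Iic (Finsupp.equivFunOnFinite.symm fun x : Fin r × Bool => (d x.2).toNat))
    (fun e => F fun x => (e x : ℤ)) fun e he => ?_), fun e => rfl⟩
  rw [Finset.mem_Iic]
  intro x
  have h1 := (hF _ he).2 x.2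
  have h2 : (e (x.1, x.2) : ℤ) ≤ ∑ i, (e (i, x.2) : ℤ) :=
    single_le_sum (f := fun i => (e (i, x.2) : ℤ)) (fun _ _ => Int.natCast_nonneg _)
      (mem_univ x.1)
  simp only [Finsupp.equivFunOnFinite_symm_apply_apply]
  have h3 : (e x : ℤ) ≤ d x.2 := h1 ▸ h2
  omega

theorem eq_zero_of_sum_permMul_one_eq_zero [CharZero K] {ι : Type*} [Fintype ι]
    (h : ι → Pairs r → Idx K) (hh : ∀ α β, (∀ p, IsIntPair K (h β p - h α p)) → α = β)
    (c : ι → DistN K E r) (m : Fin r → Idx K)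
    (hc : ∀ α g, c α (point (m + headShift (h α)) g) ≠ 0 → ∀ x, 0 ≤ g x)
    (hzero : ∀ m, ∑ α, permMul K E 1 (h α) (c α) m = 0) (α : ι) (g : Fin r × Bool → ℤ) :
    c α (point (m + headShift (h α)) g) = 0 := by
  by_contra hne
  obtain ⟨φ, hφ⟩ : ∃ φ : Module.Dual K E, φ (c α (point (m + headShift (h α)) g)) ≠ 0 := by
    by_contra! hall
    exact hne ((Module.forall_dual_apply_eq_zero_iff K _).1 hall)
  let F : ι → (Fin r × Bool → ℤ) → K := fun β g' =>
    if ∀ b, ∑ i, g' (i, b) = ∑ i, g (i, b) then φ (c β (point (m + headShift (h β)) g')) else 0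
  have hF : ∀ β g', F β g' ≠ 0 → (∀ x, 0 ≤ g' x) ∧ ∀ b, ∑ i, g' (i, b) = ∑ i, g (i, b) := by
    intro β g' hg'
    have hd : ∀ b, ∑ i, g' (i, b) = ∑ i, g (i, b) := by
      by_contra hd
      exact hg' (if_neg hd)
    refine ⟨hc β g' fun h0 => hg' ?_, hd⟩
    simp [F, h0]
  choose P hP using fun β => exists_polynomial (F β) _ (hF β)
  have hPzero : P = 0 := by
    refine eq_zero_of_sum_toSeries_mul_prod_factor K
      (fun β q => if q.2 then (h β q.1).2 else (h β q.1).1) (fun β γ hβγ => hh β γ fun p => ?_) P ?_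
    · exact ⟨by simpa [IsInt] using hβγ (p, false), by simpa [IsInt] using hβγ (p, true)⟩
    · ext n g'
      rw [map_sum, AddMonoidAlgebra.coeff_sum, Finsupp.finsetSum_apply]
      simp only [fun β => coeff_coeff_toSeries_mul_prod_factor K (P β) (F β) (hP β)
        (fun g hg => (hF β g hg).1) (h β) g' n]
      by_cases hw : weight r g' = n
      · simp only [hw, if_true]
        by_cases hd : ∀ b, ∑ i, g' (i, b) = ∑ i, g (i, b)
        · have := congrArg φ (hzero (point m g'))
          simp only [permMul_one_point_eq_sum m _ _ (hc _) g' n hw, map_sum, map_smul, map_zero,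
            smul_eq_mul] at this
          simpa [F, sum_sub_distrib, sum_twist, hd] using this
        · have h0 : ∀ β κ, F β (g' - twist κ) = 0 := fun β κ => if_neg (by
            simpa only [Pi.sub_apply, sum_sub_distrib, sum_twist, sub_zero] using hd)
          simp [h0]
      · simp [hw]
  have hg := hc α g hne
  refine hφ ?_
  have h1 := hP α (Finsupp.equivFunOnFinite.symm fun x => (g x).toNat)
  have h2 : (fun x => (((Finsupp.equivFunOnFinite.symm fun x => (g x).toNat) x : ℕ) : ℤ)) = g :=
    funext fun x => Int.toNat_of_nonneg (hg x)
  rw [h2, hPzero] at h1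
  simpa [F] using h1.symm

open Filter in
theorem eventually_nonneg_of_isNegInt [CharZero K] (a : K) :
    ∀ᶠ N : ℕ in atTop, ∀ z : ℤ, IsNegInt K (a + N - z) → 0 ≤ z := by
  by_cases ha : ∃ q : ℤ, (q : K) = a
  · obtain ⟨q, rfl⟩ := ha
    filter_upwards [eventually_ge_atTop q.natAbs] with N hN z ⟨k, hk, hkz⟩
    have : k = q + N - z := by exact_mod_cast hkz
    omega
  · refine Eventually.of_forall fun N z ⟨k, _, hkz⟩ => absurd ⟨k - N + z, ?_⟩ ha
    push_cast
    linear_combination hkz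

open Filter in
theorem eventually_nonneg_of_inLatN [CharZero K] {c : DistN K E r} (hc : InLatN K E c)
    (b : Fin r → Idx K) : ∀ᶠ N : ℕ in atTop, ∀ g : Fin r × Bool → ℤ,
      c (point (b + fun _ => ((N : K), (N : K))) g) ≠ 0 → ∀ x, 0 ≤ g x := by
  obtain ⟨S, hS⟩ := hc
  have h1 : ∀ᶠ N : ℕ in atTop, ∀ m ∈ S, ∀ i, (∀ z : ℤ, IsNegInt K ((b i).1 - (m i).1 + N - z) →
      0 ≤ z) ∧ ∀ z : ℤ, IsNegInt K ((b i).2 - (m i).2 + N - z) → 0 ≤ z :=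
    (eventually_all_finset S).2 fun m _ => eventually_all.2 fun i =>
      (eventually_nonneg_of_isNegInt _).and (eventually_nonneg_of_isNegInt _)
  filter_upwards [h1] with N hN g hg
  obtain ⟨m, hm, hneg⟩ := hS _ hg
  rintro ⟨i, _ | _⟩
  · refine (hN m hm i).1 _ ?_
    convert (hneg i).1 using 1
    simp only [point, Pi.add_apply, Prod.fst_add]
    ring
  · refine (hN m hm i).2 _ ?_
    convert (hneg i).2 using 1
    simp only [point, Pi.add_apply, Prod.snd_add]
    ring

end Independence

/-- if Σ_α (Π_{i<j}(𝐳_i−𝐳_j)^{−𝐡_{ij}^{α(i,j)}})·c^α = 0 with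
c^α ∈ E⌊𝐳₁,…,𝐳ᵣ⌋ and reduced exponents, then all c^α vanish. -/
theorem stmt_15 (K : Type*) [Field K] [CharZero K]
    (E : Type*) [AddCommGroup E] [Module K E]
    (r : ℕ) (rij : Fin r → Fin r → ℕ)
    (hs : ∀ i j : Fin r, Fin (rij i j) → Idx K)
    (hred : ∀ i j k l, k ≠ l → ¬ IsIntPair K (hs i j k - hs i j l))
    (c : ((p : Pairs r) → Fin (rij p.1.1 p.1.2)) → DistN K E r)
    (hlat : ∀ α, InLatN K E (c α))
    (hzero : ∀ m : Fin r → Idx K,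
      (∑ α : (p : Pairs r) → Fin (rij p.1.1 p.1.2),
        permMul K E (1 : Equiv.Perm (Fin r))
          (fun p => -(hs p.1.1 p.1.2 (α p))) (c α) m) = 0) :
    ∀ α, c α = 0 := by
  intro α
  funext n
  let h : ((p : Pairs r) → Fin (rij p.1.1 p.1.2)) → Pairs r → Idx K :=
    fun α p => -(hs p.1.1 p.1.2 (α p))
  obtain ⟨N, hN⟩ := (Filter.eventually_all.2 fun β => eventually_nonneg_of_inLatN (hlat β)
    (n - headShift (h α) + headShift (h β))).exists
  have key := eq_zero_of_sum_permMul_one_eq_zero h (fun β γ hβγ => ?_) c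
    (n - headShift (h α) + fun _ => ((N : K), (N : K))) (fun β g hg => hN β g ?_) hzero α
    fun _ => (N : ℤ)
  · have hn : point ((n - headShift (h α) + fun _ => ((N : K), (N : K))) + headShift (h α))
        (fun _ => (N : ℤ)) = n := by
      ext i <;> simp only [point, Pi.add_apply, Pi.sub_apply, Prod.fst_add, Prod.snd_add,
        Prod.fst_sub, Prod.snd_sub, Int.cast_natCast] <;> ring
    rwa [hn] at key
  · funext p
    by_contra hne
    refine hred _ _ _ _ hne ?_
    simpa [h, sub_eq_add_neg, add_comm] using hβγ p
  · rwa [add_right_comm] at hg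

end OPEA
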